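/- arXiv:1509.05396 — 4 statements merged into one kernel-verified Lean document; each statement's English description precedes it below -/
import Mathlib

section
/- For infinitely many positive integers n, every factor of the characteristic Sturmian word c of length n is a palindrome pair (i.e., the characteristic Sturmian word has property PP). -/
/-- A word over {0,1} (represented as `List Bool`) is a *palindrome pair*
if it is a concatenation of two palindromes. -/
def PalPair (w : List Bool) : Prop :=
  ∃ p q : List Bool, p.Palindrome ∧ q.Palindrome ∧ w = p ++ q

/-- `wpow w k` is the `k`-fold concatenation `w^k`. -/
def wpow (w : List Bool) (k : ℕ) : List Bool := (List.replicate k w).flatten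

/-- The standard words: `s 0 = 1`, `s 1 = 0`, `s n = s (n-1) ^ (a (n-1)) ++ s (n-2)`
(here `false` plays the role of the letter 0 and `true` that of the letter 1). -/
def stdWord (a : ℕ → ℕ) : ℕ → List Bool
  | 0 => [true]
  | 1 => [false]
  | (n+2) => wpow (stdWord a (n+1)) (a (n+1)) ++ stdWord a n

/-- `w` is a factor of the characteristic Sturmian word with directive sequence `a`
iff it is a factor of some standard word `s m`. -/
def IsFactorC (a : ℕ → ℕ) (w : List Bool) : Prop :=
  ∃ m, w <:+: stdWord a m

theorem wpow_succ (w : List Bool) (k : ℕ) : wpow w (k + 1) = w ++ wpow w k := by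
  simp [wpow, List.replicate_succ]

theorem wpow_append_self (w : List Bool) (k : ℕ) : wpow w k ++ w = w ++ wpow w k := by
  induction k with
  | zero => simp [wpow]
  | succ k ih => rw [wpow_succ, List.append_assoc, ih]

theorem wpow_append_eq {v P : List Bool} (h : v ++ P = P ++ v.reverse) (k : ℕ) :
    wpow v k ++ P = P ++ (wpow v k).reverse := by
  induction k with
  | zero => simp [wpow]
  | succ k ih =>
    rw [wpow_succ, List.append_assoc, ih, ← wpow_append_self, List.reverse_append,
      ← List.append_assoc, h, List.append_assoc]

/-- A word that turns a palindrome into a palindrome when put in front of it is a palindrome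
pair. -/
theorem palPair_of_append_eq {u : List Bool} (P : List Bool) (hP : P.reverse = P)
    (h : u ++ P = P ++ u.reverse) : PalPair u := by
  induction hn : P.length using Nat.strong_induction_on generalizing P with
  | _ n ih =>
    subst hn
    rcases List.append_eq_append_iff.1 h with ⟨P', hP', -⟩ | ⟨t, ht, ht'⟩
    · subst hP'
      by_cases hu : u = []
      · exact ⟨[], [], .nil, .nil, by simp [hu]⟩
      · have h' : u ++ P' = P' ++ u.reverse := by
          simpa only [List.append_assoc, List.append_cancel_left_eq] using h
        refine ih P'.length ?_ P' ?_ h' rfl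
        · have := List.length_pos_iff.2 hu
          simp only [List.length_append]
          omega
        · rw [List.reverse_append, h'] at hP
          exact List.append_cancel_right hP
    · refine ⟨P, t, .of_reverse_eq hP, .of_reverse_eq ?_, ht⟩
      subst ht
      rw [List.reverse_append, hP] at ht'
      exact List.append_cancel_right ht'

theorem PalPair.rotate_one {c : Bool} {l : List Bool} (h : PalPair (c :: l)) :
    PalPair (l ++ [c]) := by
  obtain ⟨p, q, hp, hq, h⟩ := h
  cases hp with
  | nil =>
    cases hq with
    | nil => simp at h
    | singleton x =>
      obtain ⟨rfl, rfl⟩ : c = x ∧ l = [] := by simpa using h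
      exact ⟨[], [c], .nil, .singleton c, rfl⟩
    | @cons_concat x m hm =>
      obtain ⟨rfl, rfl⟩ : c = x ∧ l = m ++ [x] := by simpa using h
      exact ⟨m, [c, c], hm, .of_reverse_eq rfl, by simp⟩
  | singleton x =>
    obtain ⟨rfl, rfl⟩ : c = x ∧ l = q := by simpa using h
    exact ⟨l, [c], hq, .singleton c, rfl⟩
  | @cons_concat x m hm =>
    obtain ⟨rfl, rfl⟩ : c = x ∧ l = m ++ (x :: q) := by simpa using h
    exact ⟨m, c :: (q ++ [c]), hm, hq.cons_concat c, by simp⟩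

theorem PalPair.append_comm {x y : List Bool} (h : PalPair (x ++ y)) : PalPair (y ++ x) := by
  induction x generalizing y with
  | nil => simpa using h
  | cons c x ih =>
    have := ih (y := y ++ [c]) (by simpa using PalPair.rotate_one h)
    simpa using this

/-- Every factor of `x` of length `L` is a palindrome pair. -/
def PalPairFactors (L : ℕ) (x : List Bool) : Prop :=
  ∀ w, w <:+: x → w.length = L → PalPair w

theorem infix_append_cases {w x y : List Bool} (h : w <:+: x ++ y) :
    w <:+: x ∨ w <:+: y ∨ ∃ w₁ w₂, w = w₁ ++ w₂ ∧ w₁ <:+ x ∧ w₂ <+: y := by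
  obtain ⟨s, t, h⟩ := h
  rcases List.append_eq_append_iff.1 h with ⟨r, hr, -⟩ | ⟨r, hr, hr'⟩
  · exact .inl ⟨s, r, hr.symm⟩
  · rcases List.append_eq_append_iff.1 hr with ⟨z, hz, hz'⟩ | ⟨z, hz, hz'⟩
    · exact .inr (.inr ⟨z, r, hz', ⟨s, hz.symm⟩, ⟨t, hr'.symm⟩⟩)
    · exact .inr (.inl ⟨z, t, by rw [hr', hz']⟩)

theorem PalPairFactors.mono {L : ℕ} {x y : List Bool} (h : PalPairFactors L y) (hxy : x <:+: y) :
    PalPairFactors L x := fun w hw => h w (hw.trans hxy)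

/-- It suffices to check a concatenation around the junction. -/
theorem PalPairFactors.append {L : ℕ} {x y x' y' : List Bool} (hx : PalPairFactors L x)
    (hy : PalPairFactors L y) (hx' : x' <:+ x) (hy' : y' <+: y) (hLx : L ≤ x'.length)
    (hLy : L ≤ y'.length) (h : PalPairFactors L (x' ++ y')) : PalPairFactors L (x ++ y) := by
  intro w hw hL
  rcases infix_append_cases hw with h₁ | h₁ | ⟨w₁, w₂, rfl, h₁, h₂⟩
  · exact hx w h₁ hL
  · exact hy w h₁ hL
  · rw [List.length_append] at hL
    obtain ⟨s, rfl⟩ := List.suffix_of_suffix_length_le h₁ hx' (by omega)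
    obtain ⟨t, rfl⟩ := List.prefix_of_prefix_length_le h₂ hy' (by omega)
    exact h _ ⟨s, t, by simp⟩ (by simpa using hL)

theorem PalPair.palPairFactors {u : List Bool} (hu : PalPair u) :
    PalPairFactors u.length u := by
  intro w hw hL
  rwa [hw.eq_of_length hL]

theorem PalPair.palPairFactors_append_self {u : List Bool} (hu : PalPair u) :
    PalPairFactors u.length (u ++ u) := by
  intro w hw hL
  rcases infix_append_cases hw with h | h | ⟨w₁, w₂, rfl, h₁, r, h₂⟩
  · exact hu.palPairFactors w h hL
  · exact hu.palPairFactors w h hL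
  · have hr : r = w₁ := by
      refine (List.suffix_of_suffix_length_le ⟨w₂, h₂⟩ h₁ ?_).eq_of_length ?_ <;>
      · simp only [← h₂, List.length_append] at hL
        omega
    subst hr
    exact PalPair.append_comm (by rwa [h₂])

/-- The words whose factors of length `u.length` are palindrome pairs and which can be
concatenated without losing this property. -/
structure GoodBlock (u v x : List Bool) : Prop where
  factors : PalPairFactors u.length x
  pre : u <+: x
  suf : u <:+ x ∨ u ++ v <:+ x

theorem GoodBlock.append {u v x y : List Bool} (huu : PalPairFactors u.length (u ++ u))
    (huvu : PalPairFactors u.length (u ++ v ++ u)) (hx : GoodBlock u v x)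
    (hy : GoodBlock u v y) : GoodBlock u v (x ++ y) where
  factors := by
    rcases hx.suf with h | h
    · exact hx.factors.append hy.factors h hy.pre le_rfl le_rfl huu
    · exact hx.factors.append hy.factors h hy.pre (by simp) le_rfl huvu
  pre := hx.pre.trans (List.prefix_append _ _)
  suf := hy.suf.imp (·.trans (List.suffix_append _ _)) (·.trans (List.suffix_append _ _))

theorem GoodBlock.wpow_append {u v x y : List Bool} (huu : PalPairFactors u.length (u ++ u))
    (huvu : PalPairFactors u.length (u ++ v ++ u)) (hx : GoodBlock u v x)
    (hy : GoodBlock u v y) (k : ℕ) : GoodBlock u v (wpow x k ++ y) := by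
  induction k with
  | zero => simpa [wpow] using hy
  | succ k ih =>
    rw [wpow_succ, List.append_assoc]
    exact hx.append huu huvu ih

/-- `P` is the central word attached to the consecutive standard words `t`, `v`. -/
structure IsCentral (t v P : List Bool) (x y : Bool) : Prop where
  pal : P.reverse = P
  left : v ++ t = P ++ [x, y]
  right : t ++ v = P ++ [y, x]
  comm_t : t ++ P = P ++ t.reverse
  comm_v : v ++ P = P ++ v.reverse

theorem IsCentral.next {t v P : List Bool} {x y : Bool} (h : IsCentral t v P x y) (k : ℕ) :
    IsCentral v (wpow v k ++ t) (wpow v k ++ P) y x where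
  pal := by rw [List.reverse_append, h.pal, wpow_append_eq h.comm_v]
  left := by simp only [List.append_assoc, h.right]
  right := by
    rw [← List.append_assoc, ← wpow_append_self, List.append_assoc, h.left, List.append_assoc]
  comm_t := by
    rw [← List.append_assoc, ← wpow_append_self, List.append_assoc, h.comm_v, List.append_assoc]
  comm_v := by
    have hk := wpow_append_eq h.comm_v k
    rw [List.append_assoc, hk, List.reverse_append, ← List.append_assoc t, h.comm_t,
      ← List.append_assoc, ← List.append_assoc, hk]
    simp only [List.append_assoc]

theorem exists_isCentral_stdWord (a : ℕ → ℕ) (m : ℕ) :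
    ∃ P x y, IsCentral (stdWord a m) (stdWord a (m + 1)) P x y := by
  induction m with
  | zero => exact ⟨[], false, true, by constructor <;> simp [stdWord]⟩
  | succ m ih =>
    obtain ⟨P, x, y, h⟩ := ih
    exact ⟨_, _, _, h.next (a (m + 1))⟩

theorem IsCentral.palPair {t v P : List Bool} {x y : Bool} (h : IsCentral t v P x y) :
    PalPair v := palPair_of_append_eq P h.pal h.comm_v

theorem IsCentral.palPairFactors_append_append {t v P : List Bool} {x y : Bool}
    (h : IsCentral t v P x y) (hv : v ≠ []) (k : ℕ) {u : List Bool}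
    (hu : u = wpow v (k + 1) ++ t) : PalPairFactors u.length (u ++ v ++ u) := by
  have hpal : PalPair u := hu ▸ (h.next (k + 1)).palPair
  have huQ : u = wpow v k ++ P ++ [x, y] := by
    rw [hu, wpow_succ, ← wpow_append_self, List.append_assoc, h.left, List.append_assoc]
  have huv : u ++ v = v ++ (wpow v k ++ P) ++ [y, x] := by
    rw [hu, (h.next (k + 1)).left, wpow_succ, List.append_assoc v]
  have hQ := (h.next k).pal
  generalize wpow v k ++ P = Q at huQ huv hQ
  have hvu : v <+: u := by rw [hu, wpow_succ, List.append_assoc]; exact List.prefix_append _ _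
  have huu := hpal.palPairFactors_append_self
  have huuu : PalPairFactors u.length (u ++ u ++ u) :=
    huu.append hpal.palPairFactors (List.suffix_append _ _) List.prefix_rfl le_rfl le_rfl huu
  obtain ⟨v', z, rfl⟩ : ∃ v' z, v = v' ++ [z] :=
    ⟨_, _, (List.dropLast_append_getLast hv).symm⟩
  have hz : z = x := by
    have : (u ++ v') ++ [z] = (v' ++ [z] ++ Q ++ [y]) ++ [x] := by simpa using huv
    simpa using List.append_inj_right' this rfl
  subst hz
  have hbase : PalPairFactors u.length (u ++ (v' ++ [z]) ++ Q) := by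
    refine huuu.mono (List.IsPrefix.isInfix ?_)
    obtain ⟨r, hr⟩ := hvu
    refine ⟨[y, z] ++ r, ?_⟩
    calc u ++ (v' ++ [z]) ++ Q ++ ([y, z] ++ r)
        = u ++ ((v' ++ [z]) ++ Q ++ [y, z]) ++ r := by simp only [List.append_assoc]
      _ = u ++ u ++ ((v' ++ [z]) ++ r) := by rw [← huv]; simp only [List.append_assoc]
      _ = u ++ u ++ u := by rw [hr]
  intro w hw hL
  have hsplit : u ++ (v' ++ [z]) ++ u = (u ++ (v' ++ [z]) ++ Q ++ [z]).concat y := by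
    conv_lhs => rw [huQ]
    rw [huQ]
    simp
  rw [hsplit, List.concat_eq_append, List.infix_concat_iff] at hw
  rcases hw with hw | hw
  · have : u <:+ u ++ (v' ++ [z]) ++ Q ++ [z] ++ [y] := by
      rw [← List.concat_eq_append, ← hsplit]
      exact List.suffix_append _ _
    rwa [(List.suffix_of_suffix_length_le hw this hL.le).eq_of_length hL]
  · rw [List.infix_concat_iff] at hw
    rcases hw with hw | hw
    · have hs : [z] ++ Q ++ [z] <:+ u ++ (v' ++ [z]) ++ Q ++ [z] := ⟨u ++ v', by simp⟩
      have hl : w.length = ([z] ++ Q ++ [z]).length := by rw [hL, huQ]; simp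
      rw [(List.suffix_of_suffix_length_le hw hs hl.le).eq_of_length hl]
      exact ⟨[z] ++ Q ++ [z], [], .of_reverse_eq (by simp [hQ]), .nil, by simp⟩
    · exact hbase w hw hL

theorem stdWord_ne_nil (a : ℕ → ℕ) : ∀ m, stdWord a m ≠ []
  | 0 => by simp [stdWord]
  | 1 => by simp [stdWord]
  | m + 2 => by simp [stdWord, stdWord_ne_nil a m]

theorem stdWord_suffix (a : ℕ → ℕ) (m k : ℕ) : stdWord a m <:+ stdWord a (m + 2 * k) := by
  induction k with
  | zero => exact List.suffix_rfl
  | succ k ih => exact ih.trans (List.suffix_append _ _)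

theorem lt_length_stdWord (a : ℕ → ℕ) (ha : ∀ n, 2 ≤ n → 1 ≤ a n) (m : ℕ) :
    m < (stdWord a (m + 2)).length := by
  induction m with
  | zero => exact List.length_pos_iff.2 (stdWord_ne_nil a _)
  | succ m ih =>
    obtain ⟨k, hk⟩ := Nat.exists_eq_add_of_le' (ha (m + 2) (by omega))
    have := List.length_pos_iff.2 (stdWord_ne_nil a (m + 1))
    change _ < (wpow (stdWord a (m + 2)) (a (m + 2)) ++ stdWord a (m + 1)).length
    rw [hk, wpow_succ]
    simp only [List.length_append]
    omega

theorem goodBlock_stdWord (a : ℕ → ℕ) (ha : ∀ n, 2 ≤ n → 1 ≤ a n) (m j : ℕ) :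
    GoodBlock (stdWord a (m + 3)) (stdWord a (m + 2)) (stdWord a (m + 3 + j)) := by
  obtain ⟨P, x, y, h⟩ := exists_isCentral_stdWord a (m + 1)
  obtain ⟨k, hk⟩ := Nat.exists_eq_add_of_le' (ha (m + 2) (by omega))
  obtain ⟨l, hl⟩ := Nat.exists_eq_add_of_le' (ha (m + 3) (by omega))
  have hu : stdWord a (m + 3) = wpow (stdWord a (m + 2)) (k + 1) ++ stdWord a (m + 1) := by
    rw [stdWord, hk]
  have hpal : PalPair (stdWord a (m + 3)) := hu ▸ (h.next (k + 1)).palPair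
  have huu := hpal.palPairFactors_append_self
  have huvu := h.palPairFactors_append_append (stdWord_ne_nil a _) k hu
  have good_u : GoodBlock (stdWord a (m + 3)) (stdWord a (m + 2)) (stdWord a (m + 3)) :=
    ⟨hpal.palPairFactors, List.prefix_rfl, .inl List.suffix_rfl⟩
  have good_uv : GoodBlock (stdWord a (m + 3)) (stdWord a (m + 2))
      (stdWord a (m + 3) ++ stdWord a (m + 2)) :=
    ⟨huvu.mono (List.prefix_append _ _).isInfix, List.prefix_append _ _, .inr List.suffix_rfl⟩
  induction j using Nat.twoStepInduction with
  | zero => exact good_u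
  | one =>
    have : stdWord a (m + 3 + 1) =
        wpow (stdWord a (m + 3)) l ++ (stdWord a (m + 3) ++ stdWord a (m + 2)) := by
      rw [stdWord, hl, wpow_succ, ← wpow_append_self, List.append_assoc]
    rw [this]
    exact good_u.wpow_append huu huvu good_uv l
  | more j ih₀ ih₁ => exact ih₁.wpow_append huu huvu ih₀ _

/-- The characteristic Sturmian word has property PP: for infinitely many
positive integers `n`, every factor of length `n` is a palindrome pair. -/
theorem sturmian_property_PP (a : ℕ → ℕ) (ha : ∀ n, 2 ≤ n → 1 ≤ a n) :
    {n : ℕ | 0 < n ∧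
      ∀ w : List Bool, IsFactorC a w → w.length = n → PalPair w}.Infinite := by
  refine Set.infinite_of_forall_exists_gt fun N => ?_
  have hN : N + 1 < (stdWord a (N + 3)).length := lt_length_stdWord a ha (N + 1)
  refine ⟨(stdWord a (N + 3)).length, ⟨by omega, ?_⟩, by omega⟩
  rintro w ⟨m, hw⟩ hL
  have hg := goodBlock_stdWord a ha N (m + (N + 3))
  rw [show N + 3 + (m + (N + 3)) = m + 2 * (N + 3) by ring] at hg
  exact hg.factors w (hw.trans (stdWord_suffix a m (N + 3)).isInfix) hL
end

section
/- For every odd positive integer n, the number of distinct factors of the Thue–Morse word t of length n that are palindrome pairs is at most 32. -/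
/-- The Thue–Morse morphism `μ` with `μ(0) = 01` and `μ(1) = 10`
(`false` plays the role of 0 and `true` that of 1). -/
def mu (w : List Bool) : List Bool :=
  (w.map (fun b => if b then [true, false] else [false, true])).flatten

/-- A finite word is a factor of the Thue–Morse word `t = μ^ω(0)` iff it is a
factor of `μ^k(0)` for some `k`. -/
def FactorTM (w : List Bool) : Prop :=
  ∃ k, w <:+: mu^[k] [false]

/-- The Thue–Morse sequence: the parity of the number of ones in the binary expansion. -/
def thueMorse (n : ℕ) : Bool :=
  if n = 0 then false else xor (thueMorse (n / 2)) (n % 2 == 1)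

theorem thueMorse_two_mul (n : ℕ) : thueMorse (2 * n) = thueMorse n := by
  rcases Nat.eq_zero_or_pos n with rfl | hn
  · rfl
  · rw [thueMorse, if_neg (by omega)]
    simp

theorem thueMorse_two_mul_add_one (n : ℕ) : thueMorse (2 * n + 1) = !thueMorse n := by
  rw [thueMorse, if_neg (by omega), show (2 * n + 1) / 2 = n by omega,
    show (2 * n + 1) % 2 = 1 by omega]
  simp

theorem thueMorse_four_mul_add (n : ℕ) {r : ℕ} (hr : r < 4) :
    thueMorse (4 * n + r) = xor (thueMorse n) (r == 1 || r == 2) := by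
  interval_cases r
  · rw [show 4 * n + 0 = 2 * (2 * n) by ring]
    simp [thueMorse_two_mul]
  · rw [show 4 * n + 1 = 2 * (2 * n) + 1 by ring]
    simp [thueMorse_two_mul, thueMorse_two_mul_add_one]
  · rw [show 4 * n + 2 = 2 * (2 * n + 1) by ring]
    simp [thueMorse_two_mul, thueMorse_two_mul_add_one]
  · rw [show 4 * n + 3 = 2 * (2 * n + 1) + 1 by ring]
    simp [thueMorse_two_mul_add_one]

/-- The Thue–Morse image of a letter under `μ ∘ μ`, indexed by position modulo 4. -/
theorem thueMorse_eq_div_four (n : ℕ) :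
    thueMorse n = xor (thueMorse (n / 4)) (n % 4 == 1 || n % 4 == 2) := by
  conv_lhs => rw [← Nat.div_add_mod n 4]
  exact thueMorse_four_mul_add _ (Nat.mod_lt _ (by norm_num))

/-- The letter at position `s` of the word `μ⁴(x) μ⁴(y)`. -/
def blockPair (x y : Bool) (s : ℕ) : Bool :=
  xor (xor (if s < 16 then x else y) (s / 4 % 4 == 1 || s / 4 % 4 == 2)) (s % 4 == 1 || s % 4 == 2)

theorem exists_blockPair (p : ℕ) :
    ∃ x y, ∀ i < 17, thueMorse (p + i) = blockPair x y (p % 16 + i) := by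
  refine ⟨thueMorse (p / 16), thueMorse (p / 16 + 1), ?_⟩
  intro i hi
  rw [thueMorse_eq_div_four, thueMorse_eq_div_four ((p + i) / 4), blockPair,
    show (p % 16 + i) / 4 % 4 = (p + i) / 4 % 4 by omega,
    show (p % 16 + i) % 4 = (p + i) % 4 by omega]
  split_ifs with h
  · rw [show (p + i) / 4 / 4 = p / 16 by omega]
  · rw [show (p + i) / 4 / 4 = p / 16 + 1 by omega]

/-- The Thue–Morse sequence has a palindrome of length `2 * m` starting at `p`. -/
def EvenPalAt (p m : ℕ) : Prop :=
  ∀ i < m, thueMorse (p + (m + i)) = thueMorse (p + (m - 1 - i))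

/-- The factor of length `m` of the Thue–Morse sequence starting at `c`. -/
def thueMorseWindow (c m : ℕ) : List Bool := (List.range m).map fun i => thueMorse (c + i)

theorem EvenPalAt.four_dvd {p m : ℕ} (h : EvenPalAt p m) (hm : 7 ≤ m) : 4 ∣ p + m := by
  obtain ⟨x, y, hw⟩ := exists_blockPair (p + m - 7)
  have key : ∀ x y, ∀ r < 16,
      (∀ i < 7, blockPair x y (r + (7 + i)) = blockPair x y (r + (6 - i))) → (r + 7) % 4 = 0 := by
    decide +kernel
  have := key x y _ (Nat.mod_lt _ (by norm_num)) fun i hi => by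
    rw [← hw _ (by omega), ← hw _ (by omega)]
    convert h i (by omega) using 2 <;> omega
  omega

theorem exists_finset_blockPair {m : ℕ} (hm : m ≤ 6) :
    ∃ F : Finset (List Bool), F.card ≤ 4 ∧
      ∀ x y, ∀ r < 16, (∀ i < m, blockPair x y (r + (m + i)) = blockPair x y (r + (m - 1 - i))) →
        (List.range m).map (fun i => blockPair x y (r + (m + i))) ∈ F := by
  interval_cases m
  · exact ⟨{[]}, by decide +kernel⟩
  · exact ⟨{[false], [true]}, by decide +kernel⟩
  · exact ⟨{[false, true], [true, false]}, by decide +kernel⟩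
  · exact ⟨{[false, true, false], [false, true, true], [true, false, false], [true, false, true]},
      by decide +kernel⟩
  · exact ⟨{[false, true, false, true], [false, true, true, false], [true, false, false, true],
      [true, false, true, false]}, by decide +kernel⟩
  · exact ⟨{[false, true, false, true, true], [false, true, true, false, true],
      [true, false, false, true, false], [true, false, true, false, false]}, by decide +kernel⟩
  · exact ⟨{[false, true, false, true, true, false], [false, true, true, false, true, false],
      [true, false, false, true, false, true], [true, false, true, false, false, true]},
      by decide +kernel⟩

/-- For each length there are at most four even palindromes in the Thue–Morse sequence, each
determined by its right half. -/
theorem exists_finset_evenPal (m : ℕ) :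
    ∃ F : Finset (List Bool), F.card ≤ 4 ∧
      ∀ p, EvenPalAt p m → thueMorseWindow (p + m) m ∈ F := by
  induction m using Nat.strong_induction_on with
  | _ m ih =>
  rcases Nat.lt_or_ge 6 m with hm | hm
  · obtain ⟨F, hF, hmem⟩ := ih ((m + 3) / 4) (by omega)
    refine ⟨F.image fun h => (List.range m).map fun i =>
      xor (h.getD (i / 4) false) (i % 4 == 1 || i % 4 == 2), Finset.card_image_le.trans hF, ?_⟩
    intro p hp
    obtain ⟨c, hc⟩ := hp.four_dvd hm
    obtain ⟨k, hk⟩ : ∃ k, (m + 3) / 4 = k := ⟨_, rfl⟩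
    rw [hk] at hmem
    have hq : EvenPalAt (c - k) k := by
      intro j hj
      have := hp (4 * j) (by omega)
      rw [show p + (m + 4 * j) = 4 * (c + j) + 0 by omega,
        show p + (m - 1 - 4 * j) = 4 * (c - 1 - j) + 3 by omega,
        thueMorse_four_mul_add _ (by norm_num), thueMorse_four_mul_add _ (by norm_num)] at this
      rw [show c - k + (k + j) = c + j by omega, show c - k + (k - 1 - j) = c - 1 - j by omega]
      simpa using this
    have hcm := hmem _ hq
    rw [show c - k + k = c by omega] at hcm
    refine Finset.mem_image.2 ⟨_, hcm, List.map_congr_left fun i hi => ?_⟩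
    have hi := List.mem_range.1 hi
    have hik : i / 4 < k := by omega
    rw [thueMorse_eq_div_four (p + m + i), hc, show (4 * c + i) / 4 = c + i / 4 by omega,
      show (4 * c + i) % 4 = i % 4 by omega]
    simp [thueMorseWindow, hik]
  · obtain ⟨F, hF, hmem⟩ := exists_finset_blockPair hm
    refine ⟨F, hF, fun p hp => ?_⟩
    obtain ⟨x, y, hw⟩ := exists_blockPair p
    have := hmem x y _ (Nat.mod_lt _ (by norm_num)) fun i hi => by
      rw [← hw _ (by omega), ← hw _ (by omega)]
      exact hp i hi
    convert this using 1
    refine List.map_congr_left fun i hi => ?_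
    have hi := List.mem_range.1 hi
    rw [← hw _ (by omega), Nat.add_assoc]

theorem mu_append (u v : List Bool) : mu (u ++ v) = mu u ++ mu v := by
  simp [mu]

theorem mu_thueMorseWindow_zero (n : ℕ) :
    mu (thueMorseWindow 0 n) = thueMorseWindow 0 (2 * n) := by
  induction n with
  | zero => rfl
  | succ n ih =>
    simp only [thueMorseWindow, zero_add] at ih ⊢
    rw [List.range_succ, List.map_append, mu_append, ih, show 2 * (n + 1) = 2 * n + 1 + 1 by ring,
      List.range_succ, List.range_succ]
    cases h : thueMorse n <;> simp [mu, h, thueMorse_two_mul, thueMorse_two_mul_add_one]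

theorem iterate_mu_false (k : ℕ) : mu^[k] [false] = thueMorseWindow 0 (2 ^ k) := by
  induction k with
  | zero => simp [thueMorseWindow, show thueMorse 0 = false by rw [thueMorse]; rfl]
  | succ k ih => rw [Function.iterate_succ_apply', ih, mu_thueMorseWindow_zero, pow_succ']

theorem FactorTM.exists_eq_thueMorseWindow {w : List Bool} (hw : FactorTM w) :
    ∃ p, w = thueMorseWindow p w.length := by
  obtain ⟨k, a, b, h⟩ := hw
  rw [iterate_mu_false] at h
  refine ⟨a.length, List.ext_getElem (by simp [thueMorseWindow]) fun i hi _ => ?_⟩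
  have := congrArg (fun l => l[a.length + i]?) h
  have hlen := congrArg List.length h
  simp [thueMorseWindow] at hlen
  have hlt : a.length + i < 2 ^ k := by omega
  simp [thueMorseWindow, hi, hlt, List.getElem?_append] at this ⊢
  exact this

theorem thueMorseWindow_add (p m n : ℕ) :
    thueMorseWindow p (m + n) = thueMorseWindow p m ++ thueMorseWindow (p + m) n := by
  simp [thueMorseWindow, List.range_add, Function.comp_def, Nat.add_assoc]

theorem apply_eq_of_palindrome {p n : ℕ} (h : (thueMorseWindow p n).Palindrome) {i : ℕ}
    (hi : i < n) : thueMorse (p + i) = thueMorse (p + (n - 1 - i)) := by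
  have := congrArg (fun l => l[i]?) h.reverse_eq
  rw [List.getElem?_reverse (by simpa [thueMorseWindow] using hi)] at this
  simpa [thueMorseWindow, hi, show n - 1 - i < n by omega] using this.symm

theorem palindrome_length_le_three {p k : ℕ}
    (h : (thueMorseWindow p (2 * k + 1)).Palindrome) : k ≤ 1 := by
  by_contra! hk
  have key : ∀ x y, ∀ r < 16, blockPair x y (r + 1) = blockPair x y (r + 3) →
      blockPair x y (r + 0) ≠ blockPair x y (r + 4) := by
    decide +kernel
  obtain ⟨x, y, hw⟩ := exists_blockPair (p + k - 2)
  have h1 := apply_eq_of_palindrome h (i := k - 1) (by omega)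
  have h2 := apply_eq_of_palindrome h (i := k - 2) (by omega)
  refine key x y ((p + k - 2) % 16) (Nat.mod_lt _ (by norm_num)) ?_ ?_
  · rw [← hw _ (by norm_num), ← hw _ (by norm_num)]
    convert h1 using 2 <;> omega
  · rw [← hw _ (by norm_num), ← hw _ (by norm_num)]
    convert h2 using 2 <;> omega

/-- The odd palindromes of the Thue–Morse sequence are `b` and `b (!b) b`. -/
theorem odd_palindrome_cases {p k : ℕ} (h : (thueMorseWindow p (2 * k + 1)).Palindrome) :
    (k = 0 ∧ ∃ b, thueMorseWindow p (2 * k + 1) = [b]) ∨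
      k = 1 ∧ ∃ b, thueMorseWindow p (2 * k + 1) = [b, !b, b] := by
  have hk := palindrome_length_le_three h
  interval_cases k
  · exact Or.inl ⟨rfl, thueMorse p, rfl⟩
  · have key : ∀ x y, ∀ r < 16, blockPair x y (r + 0) = blockPair x y (r + 2) →
        blockPair x y (r + 1) = !blockPair x y (r + 0) := by
      decide +kernel
    obtain ⟨x, y, hw⟩ := exists_blockPair p
    have h0 : thueMorse (p + 0) = thueMorse (p + 2) :=
      apply_eq_of_palindrome h (i := 0) (by norm_num)
    have h1 := key x y (p % 16) (Nat.mod_lt _ (by norm_num))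
    rw [← hw _ (by norm_num), ← hw _ (by norm_num), ← hw _ (by norm_num)] at h1
    refine Or.inr ⟨rfl, thueMorse p, ?_⟩
    have h1 := h1 h0
    simp only [add_zero] at h0 h1
    simp [thueMorseWindow, List.range_succ, ← h0, h1]

theorem even_palindrome_eq {p m : ℕ} (h : (thueMorseWindow p (2 * m)).Palindrome) :
    EvenPalAt p m ∧ thueMorseWindow p (2 * m) =
      (thueMorseWindow (p + m) m).reverse ++ thueMorseWindow (p + m) m := by
  have hp : EvenPalAt p m := fun i hi => by
    rw [apply_eq_of_palindrome h (i := m + i) (by omega)]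
    congr 2
    omega
  refine ⟨hp, ?_⟩
  rw [two_mul, thueMorseWindow_add]
  congr 1
  refine List.ext_getElem (by simp [thueMorseWindow]) fun i hi _ => ?_
  have hi : i < m := by simpa [thueMorseWindow] using hi
  simp only [thueMorseWindow, List.getElem_reverse, List.getElem_map, List.getElem_range,
    List.length_map, List.length_range]
  rw [Nat.add_assoc, hp _ (by omega)]
  congr 2
  omega

/-- Attach the odd palindrome `o` to the even palindrome with right half `h`, on the left
if `s` holds and on the right otherwise. -/
def attach (o h : List Bool) (s : Bool) : List Bool :=
  if s then o ++ (h.reverse ++ h) else h.reverse ++ h ++ o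

theorem card_image_attach_le {F : Finset (List Bool)} (hF : F.card ≤ 4) (o : Bool → List Bool) :
    ((F ×ˢ (Finset.univ : Finset (Bool × Bool))).image
      fun x => attach (o x.2.1) x.1 x.2.2).card ≤ 16 := by
  refine Finset.card_image_le.trans ?_
  rw [Finset.card_product]
  simp
  omega

theorem exists_attach {p q k l : ℕ} (s : Bool) {F : ℕ → Finset (List Bool)}
    (hF : ∀ m p, EvenPalAt p m → thueMorseWindow (p + m) m ∈ F m)
    (ho : (thueMorseWindow p (2 * k + 1)).Palindrome)
    (he : (thueMorseWindow q (2 * l)).Palindrome) :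
    ∃ h b, (h ∈ F (k + l) ∧ attach [b] h s = attach (thueMorseWindow p (2 * k + 1))
          (thueMorseWindow (q + l) l) s) ∨
      h ∈ F (k + l - 1) ∧ attach [b, !b, b] h s = attach (thueMorseWindow p (2 * k + 1))
          (thueMorseWindow (q + l) l) s := by
  have hl := hF l q (even_palindrome_eq he).1
  rcases odd_palindrome_cases ho with ⟨rfl, b, hb⟩ | ⟨rfl, b, hb⟩
  · exact ⟨_, b, Or.inl ⟨by simpa using hl, by rw [hb]⟩⟩
  · exact ⟨_, b, Or.inr ⟨by simpa using hl, by rw [hb]⟩⟩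

/-- For every odd positive integer `n`, the Thue–Morse word has at most 32
factors of length `n` that are palindrome pairs. -/
theorem thueMorse_few_odd_palPair_factors (n : ℕ) (hpos : 0 < n) (hodd : Odd n) :
    {u : List Bool | FactorTM u ∧ u.length = n ∧ PalPair u}.ncard ≤ 32 := by
  obtain ⟨k, rfl⟩ := hodd
  choose F hcard hF using exists_finset_evenPal
  obtain ⟨G, hG, hmem⟩ : ∃ G : ℕ → (Bool → List Bool) → Finset (List Bool),
      (∀ m o, (G m o).card ≤ 16) ∧ ∀ m o h b s, h ∈ F m → attach (o b) h s ∈ G m o :=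
    ⟨fun m o => (F m ×ˢ (Finset.univ : Finset (Bool × Bool))).image
      fun x => attach (o x.2.1) x.1 x.2.2, fun m o => card_image_attach_le (hcard m) o,
      fun m o h b s hh => Finset.mem_image.2 ⟨(h, b, s), by simpa using hh, rfl⟩⟩
  have hsub : {u : List Bool | FactorTM u ∧ u.length = 2 * k + 1 ∧ PalPair u} ⊆
      ↑(G k (fun b => [b]) ∪ G (k - 1) fun b => [b, !b, b]) := by
    rintro _ ⟨hf, hlen, p, q, hp, hq, rfl⟩
    obtain ⟨c, hc⟩ := hf.exists_eq_thueMorseWindow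
    rw [List.length_append] at hc hlen
    rw [thueMorseWindow_add] at hc
    obtain ⟨hcp, hcq⟩ := List.append_inj hc (by simp [thueMorseWindow])
    rw [hcp] at hp
    rw [hcq] at hq
    rw [hc, Finset.mem_coe, Finset.mem_union]
    generalize p.length = i at *
    generalize q.length = j at *
    rcases Nat.even_or_odd' i with ⟨l, rfl | rfl⟩
    · obtain ⟨d, rfl⟩ : ∃ d, j = 2 * d + 1 := ⟨k - l, by omega⟩
      obtain ⟨h, b, hb⟩ := exists_attach false hF hq hp
      rw [(even_palindrome_eq hp).2]
      change attach (thueMorseWindow (c + 2 * l) (2 * d + 1))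
        (thueMorseWindow (c + l) l) false ∈ _ ∨ attach _ _ false ∈ _
      rw [show d + l = k by omega] at hb
      rcases hb with ⟨hh, hb⟩ | ⟨hh, hb⟩
      · exact Or.inl (hb ▸ hmem k (fun b => [b]) h b false hh)
      · exact Or.inr (hb ▸ hmem (k - 1) (fun b => [b, !b, b]) h b false hh)
    · obtain ⟨d, rfl⟩ : ∃ d, j = 2 * d := ⟨k - l, by omega⟩
      obtain ⟨h, b, hb⟩ := exists_attach true hF hp hq
      rw [(even_palindrome_eq hq).2]
      change attach (thueMorseWindow c (2 * l + 1))
        (thueMorseWindow (c + (2 * l + 1) + d) d) true ∈ _ ∨ attach _ _ true ∈ _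
      rw [show l + d = k by omega] at hb
      rcases hb with ⟨hh, hb⟩ | ⟨hh, hb⟩
      · exact Or.inl (hb ▸ hmem k (fun b => [b]) h b true hh)
      · exact Or.inr (hb ▸ hmem (k - 1) (fun b => [b, !b, b]) h b true hh)
  refine (Set.ncard_le_ncard hsub (Finset.finite_toSet _)).trans ?_
  rw [Set.ncard_coe_finset]
  exact (Finset.card_union_le _ _).trans (Nat.add_le_add (hG _ _) (hG _ _))
end

section
/- Let w be a minimal non palindrome pair over {0,1} with an internal maximum block, and let w' be the word obtained from w by extending that internal maximum block, i.e., inserting one or more additional copies of its letter into that block. Then w' is also a minimal non palindrome pair. -/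
/-- `u` is a proper factor of `w`: a factor (contiguous subword) other than
`w` itself. -/
def ProperFactor (u w : List Bool) : Prop :=
  u <:+: w ∧ u ≠ w

/-- A *minimal non palindrome pair*: a word that is not a palindrome pair but
all of whose proper factors are palindrome pairs. -/
def MNPP (w : List Bool) : Prop :=
  ¬ PalPair w ∧ ∀ u, ProperFactor u w → PalPair u

/-- `IsBlock w c m` says that `w` has a block (maximal run) of the letter `c`
of length `m`: an occurrence of `c^m` that cannot be extended on either side. -/
def IsBlock (w : List Bool) (c : Bool) (m : ℕ) : Prop :=
  0 < m ∧ ∃ p s : List Bool, w = p ++ List.replicate m c ++ s ∧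
    p.getLast? ≠ some c ∧ s.head? ≠ some c

/-- `w` has an *internal maximum block*: a block that is neither the first nor
last block of `w` (so it is flanked on both sides by the other letter) and
whose length is at least that of every block of `w`. -/
def HasInternalMaxBlock (w : List Bool) : Prop :=
  ∃ (c : Bool) (m : ℕ) (u v : List Bool), 0 < m ∧
    w = u ++ List.replicate m c ++ v ∧
    u.getLast? = some (!c) ∧ v.head? = some (!c) ∧
    ∀ c' m', IsBlock w c' m' → m' ≤ m

theorem PalPair.exists_index {w : List Bool} (h : PalPair w) :
    ∃ i ≤ w.length, (∀ k < i, w[k]? = w[i - 1 - k]?) ∧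
      ∀ k, i ≤ k → k < w.length → w[k]? = w[w.length - 1 + i - k]? := by
  obtain ⟨p, q, hp, hq, rfl⟩ := h
  refine ⟨p.length, by simp, fun k hk => ?_, fun k hk hk' => ?_⟩
  · rw [List.getElem?_append_left hk, List.getElem?_append_left (by omega),
      ← List.getElem?_reverse hk, hp.reverse_eq]
  · rw [List.length_append] at hk' ⊢
    rw [List.getElem?_append_right hk, List.getElem?_append_right (by omega)]
    conv_lhs => rw [← hq.reverse_eq, List.getElem?_reverse (by omega)]
    congr 1
    omega

theorem PalPair.reverse {w : List Bool} (h : PalPair w) : PalPair w.reverse := by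
  obtain ⟨p, q, hp, hq, rfl⟩ := h
  exact ⟨q, p, hq, hp, by rw [List.reverse_append, hp.reverse_eq, hq.reverse_eq]⟩

theorem MNPP.reverse {w : List Bool} (h : MNPP w) : MNPP w.reverse := by
  refine ⟨fun h' => h.1 (by simpa using h'.reverse), fun u hu => ?_⟩
  have := (h.2 u.reverse ⟨by simpa using List.reverse_infix.2 hu.1,
    fun e => hu.2 (by rw [← e, List.reverse_reverse])⟩).reverse
  simpa using this

theorem MNPP.eq_of_infix {w f : List Bool} (h : MNPP w) (hf : f <:+: w) (hn : ¬ PalPair f) :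
    f = w :=
  not_not.1 fun hne => hn (h.2 f ⟨hf, hne⟩)

theorem palindrome_replicate (n : ℕ) (c : Bool) : (List.replicate n c).Palindrome :=
  List.Palindrome.of_reverse_eq (by simp)

/-- A palindrome extended on both sides by powers of the same letter is a palindrome pair. -/
theorem palPair_replicate_append_replicate {z : List Bool} (hz : z.reverse = z) (c : Bool)
    (k l : ℕ) : PalPair (List.replicate k c ++ z ++ List.replicate l c) := by
  rcases le_total k l with h | h
  · obtain ⟨e, rfl⟩ := Nat.exists_eq_add_of_le h
    exact ⟨List.replicate k c ++ z ++ List.replicate k c, List.replicate e c,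
      List.Palindrome.of_reverse_eq (by simp [hz]), palindrome_replicate _ _,
      by simp only [List.replicate_add, List.append_assoc]⟩
  · obtain ⟨e, rfl⟩ := Nat.exists_eq_add_of_le' h
    exact ⟨List.replicate e c, List.replicate l c ++ z ++ List.replicate l c,
      palindrome_replicate _ _, List.Palindrome.of_reverse_eq (by simp [hz]),
      by simp only [List.replicate_add, List.append_assoc]⟩

/-- All factors of `w`, including `w` itself, are palindrome pairs. -/
def AllFactorsPalPair (w : List Bool) : Prop := ∀ u, u <:+: w → PalPair u

theorem infix_cons_concat {u t : List Bool} {a b : Bool} (h : u <:+: a :: (t ++ [b])) :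
    u = a :: (t ++ [b]) ∨ u <:+: a :: t ∨ u <:+: t ++ [b] := by
  rcases List.infix_cons_iff.1 h with h | h
  · rw [← List.cons_append, List.prefix_concat_iff] at h
    rcases h with h | h
    · exact .inl h
    · exact .inr (.inl h.isInfix)
  · exact .inr (.inr h)

theorem mnpp_cons_concat {t : List Bool} {a b : Bool} (h : ¬ PalPair (a :: (t ++ [b])))
    (h₁ : AllFactorsPalPair (a :: t)) (h₂ : AllFactorsPalPair (t ++ [b])) :
    MNPP (a :: (t ++ [b])) := by
  refine ⟨h, fun u hu => ?_⟩
  rcases infix_cons_concat hu.1 with e | e | e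
  · exact absurd e hu.2
  · exact h₁ u e
  · exact h₂ u e

theorem allFactorsPalPair_three_blocks (x y : Bool) (a b c : ℕ) :
    AllFactorsPalPair (List.replicate a x ++ List.replicate b y ++ List.replicate c x) := by
  rintro u ⟨s, t, h⟩
  have hu : u = ((List.replicate a x ++ List.replicate b y ++ List.replicate c x).drop
      s.length).take u.length := by
    rw [← h]; simp
  rw [hu]
  simp only [List.drop_append, List.take_append, List.drop_replicate, List.take_replicate]
  exact palPair_replicate_append_replicate (by simp) _ _ _

theorem AllFactorsPalPair.reverse {w : List Bool} (h : AllFactorsPalPair w) :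
    AllFactorsPalPair w.reverse := fun u hu => by
  simpa using (h u.reverse (by simpa using List.reverse_infix.2 hu)).reverse

theorem allFactorsPalPair_four_blocks (x y : Bool) (p q : ℕ) :
    AllFactorsPalPair (x :: (List.replicate p y ++ x :: List.replicate q y)) := by
  induction q with
  | zero => simpa using allFactorsPalPair_three_blocks x y 1 p 1
  | succ q ih =>
    intro u hu
    have e : x :: (List.replicate p y ++ x :: List.replicate (q + 1) y) =
        x :: ((List.replicate p y ++ x :: List.replicate q y) ++ [y]) := by
      simp [List.replicate_succ']
    rw [e] at hu
    rcases infix_cons_concat hu with h | h | h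
    · rw [h, ← e]
      simpa using palPair_replicate_append_replicate
        (z := x :: (List.replicate p y ++ [x])) (by simp) y 0 (q + 1)
    · exact ih u h
    · refine allFactorsPalPair_three_blocks y x p 1 (q + 1) u ?_
      simpa [List.replicate_succ'] using h

theorem not_palPair_one_p_q_one {x y : Bool} (hxy : x ≠ y) {p q : ℕ} (hp : 2 ≤ p) (hq : 2 ≤ q) :
    ¬ PalPair (x :: (List.replicate p y ++ List.replicate q x ++ [y])) := by
  intro h
  obtain ⟨i, hi, h₁, h₂⟩ := h.exists_index
  set w := x :: (List.replicate p y ++ List.replicate q x ++ [y]) with hw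
  have hl : w.length = p + q + 2 := by simp [hw]; omega
  have key : ∀ k < p + q + 2, w[k]? = some x ↔ k = 0 ∨ (p + 1 ≤ k ∧ k ≤ p + q) := by
    intro k hk
    rcases k with _ | k
    · simp [hw]
    · simp only [hw, List.getElem?_cons_succ, List.getElem?_append, List.getElem?_replicate,
        List.length_append, List.length_replicate, List.getElem?_singleton]
      split_ifs <;> simp [hxy.symm] <;> omega
  have e₁ : ∀ k < i, ((k = 0 ∨ (p + 1 ≤ k ∧ k ≤ p + q)) ↔
      (i - 1 - k = 0 ∨ (p + 1 ≤ i - 1 - k ∧ i - 1 - k ≤ p + q))) := fun k hk => by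
    rw [← key k (by omega), ← key (i - 1 - k) (by omega), h₁ k hk]
  have e₂ : ∀ k, i ≤ k → k < p + q + 2 → ((k = 0 ∨ (p + 1 ≤ k ∧ k ≤ p + q)) ↔
      (p + q + 2 - 1 + i - k = 0 ∨ (p + 1 ≤ p + q + 2 - 1 + i - k ∧
        p + q + 2 - 1 + i - k ≤ p + q))) := fun k hk hk' => by
    rw [← key k (by omega), ← key (p + q + 2 - 1 + i - k) (by omega), h₂ k hk (by omega), hl]
  have a := e₁ 0
  have b := e₁ 1
  have c := e₂ i le_rfl
  have d := e₂ (i + 1) (by omega)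
  omega

theorem not_palPair_two_m_one_one {x y : Bool} (hxy : x ≠ y) {m : ℕ} (hm : 2 ≤ m) :
    ¬ PalPair (x :: x :: (List.replicate m y ++ [x, y])) := by
  intro h
  obtain ⟨i, hi, h₁, h₂⟩ := h.exists_index
  set w := x :: x :: (List.replicate m y ++ [x, y]) with hw
  have hl : w.length = m + 4 := by simp [hw]
  have key : ∀ k < m + 4, w[k]? = some x ↔ k = 0 ∨ k = 1 ∨ k = m + 2 := by
    intro k hk
    rcases k with _ | _ | k
    · simp [hw]
    · simp [hw]
    · simp only [hw, List.getElem?_cons_succ, List.getElem?_append, List.getElem?_replicate,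
        List.length_replicate]
      split_ifs with h
      · simp [hxy.symm]; omega
      · obtain h | h : k = m ∨ k = m + 1 := by omega
        · simp [h]
        · simp [h, hxy.symm]
  have e₁ : ∀ k < i, ((k = 0 ∨ k = 1 ∨ k = m + 2) ↔
      (i - 1 - k = 0 ∨ i - 1 - k = 1 ∨ i - 1 - k = m + 2)) := fun k hk => by
    rw [← key k (by omega), ← key (i - 1 - k) (by omega), h₁ k hk]
  have e₂ : ∀ k, i ≤ k → k < m + 4 → ((k = 0 ∨ k = 1 ∨ k = m + 2) ↔
      (m + 4 - 1 + i - k = 0 ∨ m + 4 - 1 + i - k = 1 ∨ m + 4 - 1 + i - k = m + 2)) :=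
    fun k hk hk' => by
    rw [← key k (by omega), ← key (m + 4 - 1 + i - k) (by omega), h₂ k hk (by omega), hl]
  have a := e₁ 0
  have b := e₁ 1
  have c := e₂ i le_rfl
  have d := e₂ (i + 1) (by omega)
  omega

theorem not_palPair_one_k_one_m_one {x y : Bool} (hxy : x ≠ y) {k m : ℕ} (hk : 1 ≤ k)
    (hkm : k < m) :
    ¬ PalPair (x :: (List.replicate k y ++ x :: List.replicate m y ++ [x])) := by
  intro h
  obtain ⟨i, hi, h₁, h₂⟩ := h.exists_index
  set w := x :: (List.replicate k y ++ x :: List.replicate m y ++ [x]) with hw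
  have hl : w.length = k + m + 3 := by simp [hw]; omega
  have key : ∀ j < k + m + 3, w[j]? = some x ↔ j = 0 ∨ j = k + 1 ∨ j = k + m + 2 := by
    intro j hj
    rcases j with _ | j
    · simp [hw]
    · simp only [hw, List.getElem?_cons_succ, List.getElem?_append, List.getElem?_replicate,
        List.length_append, List.length_replicate, List.getElem?_cons,
        List.length_cons]
      split_ifs <;> simp [hxy.symm] <;> omega
  have e₁ : ∀ j < i, ((j = 0 ∨ j = k + 1 ∨ j = k + m + 2) ↔
      (i - 1 - j = 0 ∨ i - 1 - j = k + 1 ∨ i - 1 - j = k + m + 2)) := fun j hj => by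
    rw [← key j (by omega), ← key (i - 1 - j) (by omega), h₁ j hj]
  have e₂ : ∀ j, i ≤ j → j < k + m + 3 → ((j = 0 ∨ j = k + 1 ∨ j = k + m + 2) ↔
      (k + m + 3 - 1 + i - j = 0 ∨ k + m + 3 - 1 + i - j = k + 1 ∨
        k + m + 3 - 1 + i - j = k + m + 2)) := fun j hj hj' => by
    rw [← key j (by omega), ← key (k + m + 3 - 1 + i - j) (by omega), h₂ j hj (by omega), hl]
  have a := e₁ 0
  have b := e₁ (k + 1)
  have c := e₂ i le_rfl
  have d := e₂ (k + 1)
  have f := e₂ (k + m + 2)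
  omega

theorem mnpp_one_p_q_one {x y : Bool} (hxy : x ≠ y) {p q : ℕ} (hp : 2 ≤ p) (hq : 2 ≤ q) :
    MNPP (x :: (List.replicate p y ++ List.replicate q x ++ [y])) :=
  mnpp_cons_concat (not_palPair_one_p_q_one hxy hp hq)
    (by simpa using allFactorsPalPair_three_blocks x y 1 p q)
    (by simpa using allFactorsPalPair_three_blocks y x p q 1)

theorem mnpp_two_m_one_one {x y : Bool} (hxy : x ≠ y) {m : ℕ} (hm : 2 ≤ m) :
    MNPP (x :: x :: (List.replicate m y ++ [x, y])) := by
  have := mnpp_cons_concat (t := x :: (List.replicate m y ++ [x])) (a := x) (b := y)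
    (by simpa using not_palPair_two_m_one_one hxy hm)
    (by simpa using allFactorsPalPair_three_blocks x y 2 m 1)
    (by simpa using allFactorsPalPair_four_blocks x y m 1)
  simpa using this

theorem mnpp_one_k_one_m_one {x y : Bool} (hxy : x ≠ y) {k m : ℕ} (hk : 1 ≤ k) (hkm : k < m) :
    MNPP (x :: (List.replicate k y ++ x :: List.replicate m y ++ [x])) :=
  mnpp_cons_concat (not_palPair_one_k_one_m_one hxy hk hkm)
    (allFactorsPalPair_four_blocks x y k m)
    (by simpa using (allFactorsPalPair_four_blocks x y m k).reverse)

theorem eq_replicate_or_exists_append {x y : Bool} (hxy : x ≠ y) (u : List Bool) :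
    (∃ k, u = List.replicate k y) ∨ ∃ t k, u = t ++ x :: List.replicate k y := by
  induction u using List.reverseRecOn with
  | nil => exact .inl ⟨0, rfl⟩
  | append_singleton u a ih =>
    obtain rfl | rfl : a = x ∨ a = y := by revert hxy; cases a <;> cases x <;> cases y <;> simp
    · exact .inr ⟨u, 0, rfl⟩
    · rcases ih with ⟨k, rfl⟩ | ⟨t, k, rfl⟩
      · exact .inl ⟨k + 1, by rw [List.replicate_succ']⟩
      · exact .inr ⟨t, k + 1, by simp [List.replicate_succ']⟩

theorem eq_replicate_or_exists_cons_append {x y : Bool} (hxy : x ≠ y) (v : List Bool) :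
    (∃ k, v = List.replicate k y) ∨ ∃ t k, v = List.replicate k y ++ x :: t := by
  rcases eq_replicate_or_exists_append hxy v.reverse with ⟨k, h⟩ | ⟨t, k, h⟩
  · exact .inl ⟨k, by rw [← List.reverse_reverse v, h, List.reverse_replicate]⟩
  · exact .inr ⟨t.reverse, k, by rw [← List.reverse_reverse v, h]; simp⟩

theorem eq_nil_or_exists_concat {x y : Bool} (hxy : x ≠ y) (u : List Bool) :
    (∃ t, u = t ++ [x]) ∨ u = [] ∨ ∃ t, u = t ++ [y] := by
  rcases u.eq_nil_or_concat with h | ⟨t, a, h⟩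
  · exact .inr (.inl h)
  · obtain rfl | rfl : a = x ∨ a = y := by revert hxy; cases a <;> cases x <;> cases y <;> simp
    · exact .inl ⟨t, by simpa using h⟩
    · exact .inr (.inr ⟨t, by simpa using h⟩)

/-- The palindrome `x (y ^ m x) ^ n`. -/
def periodicPal (x y : Bool) (m : ℕ) : ℕ → List Bool
  | 0 => [x]
  | n + 1 => periodicPal x y m n ++ (List.replicate m y ++ [x])

theorem periodicPal_append (x y : Bool) (m a b : ℕ) :
    periodicPal x y m a ++ (List.replicate m y ++ periodicPal x y m b) =
      periodicPal x y m (a + b + 1) := by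
  induction b with
  | zero => rfl
  | succ b ih =>
    rw [show a + (b + 1) + 1 = (a + b + 1) + 1 by omega, periodicPal, periodicPal, ← ih]
    simp only [List.append_assoc]

theorem reverse_periodicPal (x y : Bool) (m n : ℕ) :
    (periodicPal x y m n).reverse = periodicPal x y m n := by
  induction n with
  | zero => rfl
  | succ n ih =>
    have := periodicPal_append x y m 0 n
    rw [Nat.zero_add] at this
    conv_rhs => rw [← this]
    simp [periodicPal, ih]

/-- Every run of a letter in `w` has length at most `m`. -/
def RunsLE (w : List Bool) (m : ℕ) : Prop := ∀ c n, List.replicate n c <:+: w → n ≤ m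

theorem RunsLE.mono {u w : List Bool} {m : ℕ} (h : RunsLE w m) (hu : u <:+: w) : RunsLE u m :=
  fun c n hn => h c n (hn.trans hu)

theorem RunsLE.reverse {w : List Bool} {m : ℕ} (h : RunsLE w m) : RunsLE w.reverse m :=
  fun c n hn => h c n (by simpa using List.reverse_infix.2 hn)

theorem runsLE_of_isBlock_le {w : List Bool} {m : ℕ} (h : ∀ c n, IsBlock w c n → n ≤ m) :
    RunsLE w m := by
  rintro c n ⟨p, s, rfl⟩
  have hc : (!c) ≠ c := by simp
  obtain ⟨p', a, rfl, hp⟩ : ∃ p' a, p = p' ++ List.replicate a c ∧ p'.getLast? ≠ some c := by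
    rcases eq_replicate_or_exists_append hc p with ⟨k, rfl⟩ | ⟨t, k, rfl⟩
    · exact ⟨[], k, rfl, by simp⟩
    · exact ⟨t ++ [!c], k, by simp, by simp⟩
  obtain ⟨s', b, rfl, hs⟩ : ∃ s' b, s = List.replicate b c ++ s' ∧ s'.head? ≠ some c := by
    rcases eq_replicate_or_exists_cons_append hc s with ⟨k, rfl⟩ | ⟨t, k, rfl⟩
    · exact ⟨[], k, by simp, by simp⟩
    · exact ⟨(!c) :: t, k, rfl, by simp⟩
  rcases Nat.eq_zero_or_pos n with rfl | hn
  · exact Nat.zero_le _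
  · have := h c (a + n + b) ⟨by omega, p', s', by simp only [List.replicate_add, List.append_assoc],
      hp, hs⟩
    omega

/-- Structure of the part of a word preceding an occurrence of `y ^ m x`, where `y ^ m` is a
maximum block. -/
theorem exists_eq_replicate_append_periodicPal {x y : Bool} (hxy : x ≠ y) {m : ℕ} (N : ℕ) :
    ∀ u : List Bool, u.length ≤ N →
      (∀ f, ProperFactor f (u ++ x :: List.replicate m y ++ [x]) → PalPair f) →
      RunsLE (u ++ x :: List.replicate m y ++ [x]) m →
      (u = [] ∨ ∃ t, u = t ++ [y]) → (∀ k < m, u ≠ x :: List.replicate k y) →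
      ∃ k n, u ++ [x] = List.replicate k y ++ periodicPal x y m n := by
  induction N with
  | zero =>
    intro u hu _ _ _ _
    rw [List.eq_nil_of_length_eq_zero (Nat.le_zero.1 hu)]
    exact ⟨0, 0, rfl⟩
  | succ N ih =>
    intro u hN hfac hrun hend hne
    rcases eq_replicate_or_exists_append hxy u with ⟨k, rfl⟩ | ⟨t, k, rfl⟩
    · exact ⟨k, 0, rfl⟩
    have hk : 1 ≤ k := by
      rcases hend with h | ⟨s, h⟩
      · simp at h
      · rcases k with _ | k
        · have := congrArg List.getLast? h
          simp [hxy] at this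
        · omega
    have hkm : k ≤ m := hrun y k ⟨t ++ [x], x :: List.replicate m y ++ [x], by simp⟩
    have ht : k < m → t ≠ [] := fun h e => hne k h (by simp [e])
    obtain rfl : k = m := by
      by_contra hkm'
      have hlt : k < m := by omega
      exact not_palPair_one_k_one_m_one hxy hk hlt (hfac _ ⟨⟨t, [], by simp⟩, fun e =>
        ht hlt (by simpa using congrArg List.length e)⟩)
    have hinf : t ++ x :: List.replicate k y ++ [x] <:+:
        t ++ x :: List.replicate k y ++ x :: List.replicate k y ++ [x] :=
      ⟨[], List.replicate k y ++ [x], by simp⟩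
    have hpal : ∀ f, f <:+: t ++ x :: List.replicate k y ++ [x] → PalPair f := fun f hf =>
      hfac f ⟨hf.trans hinf, fun e => by
        have := hf.length_le
        rw [e] at this
        simp at this⟩
    obtain ⟨j, n, h⟩ := ih t (by simp at hN; omega) (fun f hf => hpal f hf.1)
      (hrun.mono hinf) (by
        rcases eq_nil_or_exists_concat hxy t with ⟨s, rfl⟩ | h
        · exfalso
          have h2 : 2 ≤ k := hrun x 2 ⟨s, List.replicate k y ++ x :: List.replicate k y ++ [x],
            by simp [List.replicate_succ]⟩
          obtain ⟨l, rfl⟩ : ∃ l, k = l + 1 := ⟨k - 1, by omega⟩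
          refine not_palPair_two_m_one_one hxy h2 (hfac _ ⟨⟨s, List.replicate l y ++ [x],
            by simp [List.replicate_succ]⟩, fun e => ?_⟩)
          have := congrArg List.length e
          simp at this
          omega
        · exact h)
      (by
        rintro j hj rfl
        rcases Nat.eq_zero_or_pos j with rfl | hj0
        · have h2 : 2 ≤ k := hrun x 2 ⟨[], List.replicate k y ++ x :: List.replicate k y ++ [x],
            by simp [List.replicate_succ]⟩
          obtain ⟨l, rfl⟩ : ∃ l, k = l + 1 := ⟨k - 1, by omega⟩
          refine not_palPair_two_m_one_one hxy h2 (hfac _ ⟨⟨[], List.replicate l y ++ [x],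
            by simp [List.replicate_succ]⟩, fun e => ?_⟩)
          have := congrArg List.length e
          simp at this
        · exact not_palPair_one_k_one_m_one hxy hj0 hj (hpal _ ⟨[], [], by simp⟩))
    refine ⟨j, n + 1, ?_⟩
    rw [periodicPal, ← List.append_assoc, ← h]
    simp

/-- Either extending `y ^ m` works, or the part before `y ^ m` has a periodic structure. -/
theorem MNPP.extend_or_periodic {x y : Bool} (hxy : x ≠ y) {m : ℕ} {u v : List Bool}
    (hw : MNPP (u ++ [x] ++ List.replicate m y ++ x :: v))
    (hrun : RunsLE (u ++ [x] ++ List.replicate m y ++ x :: v) m) :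
    (∀ d, MNPP (u ++ [x] ++ List.replicate (m + d) y ++ x :: v)) ∨
      ∃ k n, u ++ [x] = List.replicate k y ++ periodicPal x y m n := by
  rcases eq_nil_or_exists_concat hxy u with ⟨s, rfl⟩ | hend
  · left
    have h2 : 2 ≤ m := hrun x 2 ⟨s, List.replicate m y ++ x :: v, by simp [List.replicate_succ]⟩
    rcases eq_replicate_or_exists_append hxy.symm s with ⟨i, rfl⟩ | ⟨t, i, rfl⟩
    · rcases eq_replicate_or_exists_cons_append hxy.symm v with ⟨j, rfl⟩ | ⟨t, j, rfl⟩
      · refine absurd ?_ hw.1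
        have e : List.replicate i x ++ [x] ++ [x] = List.replicate (i + 2) x := by
          simp [List.replicate_succ']
        rw [e, ← List.replicate_succ]
        exact palPair_replicate_append_replicate (by simp) x _ _
      · rcases Nat.eq_zero_or_pos j with rfl | hj
        · have e := hw.eq_of_infix ⟨List.replicate i x, t, by simp⟩
            (not_palPair_two_m_one_one hxy h2)
          have := congrArg List.length e
          simp at this
          obtain rfl : i = 0 := by omega
          obtain rfl : t = [] := List.eq_nil_of_length_eq_zero (by omega)
          intro d
          simpa using mnpp_two_m_one_one hxy (m := m + d) (by omega)
        · have e := hw.eq_of_infix ⟨List.replicate i x ++ [x], t,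
            by simp [List.replicate_succ]⟩
            (not_palPair_one_p_q_one hxy h2 (q := j + 1) (by omega))
          have := congrArg List.length e
          simp at this
          omega
    · have e := hw.eq_of_infix ⟨t, v, by simp [List.replicate_succ']⟩
        (not_palPair_one_p_q_one hxy.symm (p := i + 2) (by omega) h2)
      have := congrArg List.length e
      simp at this
      obtain rfl : t = [] := List.eq_nil_of_length_eq_zero (by omega)
      obtain rfl : v = [] := List.eq_nil_of_length_eq_zero (by omega)
      intro d
      simpa [List.replicate_succ'] using
        mnpp_one_p_q_one hxy.symm (p := i + 2) (q := m + d) (by omega) (by omega)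
  · by_cases hex : ∃ k < m, u = x :: List.replicate k y
    · left
      obtain ⟨k, hk, rfl⟩ := hex
      have hk1 : 1 ≤ k := by
        rcases hend with h | ⟨s, h⟩
        · simp at h
        · rcases k with _ | k
          · have := congrArg List.getLast? h
            simp [hxy] at this
          · omega
      have e := hw.eq_of_infix ⟨[], v, by simp⟩ (not_palPair_one_k_one_m_one hxy hk1 hk)
      have := congrArg List.length e
      obtain rfl : v = [] := by simpa using this
      intro d
      simpa using mnpp_one_k_one_m_one hxy (m := m + d) hk1 (by omega)
    · right
      have hinf : u ++ x :: List.replicate m y ++ [x] <:+: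
          u ++ [x] ++ List.replicate m y ++ x :: v := ⟨[], v, by simp⟩
      refine exists_eq_replicate_append_periodicPal hxy (m := m) u.length u le_rfl
        (fun f hf => hw.2 f ⟨hf.1.trans hinf, fun e => ?_⟩) (hrun.mono hinf) hend
        (fun k hk e => hex ⟨k, hk, e⟩)
      subst e
      exact hf.2 (hf.1.eq_of_length_le hinf.length_le)

/-- Extending an internal maximum block of a minimal non palindrome pair
(inserting `d ≥ 1` additional copies of its letter) yields a minimal non
palindrome pair. -/
theorem mnpp_extend_internal_max_block (w : List Bool) (hw : MNPP w)
    (c : Bool) (m : ℕ) (u v : List Bool) (hm : 0 < m)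
    (hdecomp : w = u ++ List.replicate m c ++ v)
    (hu : u.getLast? = some (!c)) (hv : v.head? = some (!c))
    (hmax : ∀ c' m', IsBlock w c' m' → m' ≤ m)
    (d : ℕ) (hd : 1 ≤ d) :
    MNPP (u ++ List.replicate (m + d) c ++ v) := by
  have hxy : (!c) ≠ c := by simp
  have hrun := runsLE_of_isBlock_le hmax
  obtain ⟨u, rfl⟩ := List.getLast?_eq_some_iff.1 hu
  obtain ⟨v, rfl⟩ := List.head?_eq_some_iff.1 hv
  generalize (!c) = x at *
  subst hdecomp
  have hrev : ∀ n, (u ++ [x] ++ List.replicate n c ++ x :: v).reverse =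
      v.reverse ++ [x] ++ List.replicate n c ++ x :: u.reverse := fun n => by simp
  rcases hw.extend_or_periodic hxy hrun with h | ⟨k, a, hka⟩
  · exact h d
  have hw' := hw.reverse
  have hrun' := hrun.reverse
  rw [hrev] at hw' hrun'
  rcases hw'.extend_or_periodic hxy hrun' with h | ⟨l, b, hlb⟩
  · simpa [hrev] using (h d).reverse
  · refine absurd ?_ hw.1
    have hv' : x :: v = periodicPal x c m b ++ List.replicate l c := by
      rw [← List.reverse_inj]
      simpa [reverse_periodicPal] using hlb
    have := palPair_replicate_append_replicate (reverse_periodicPal x c m (a + b + 1)) c k l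
    rw [← periodicPal_append] at this
    rw [hka, hv']
    simpa using this
end

section
/- Let npp(i) denote the number of binary words of length i that are minimal non palindrome pairs. Then npp(i) = 0 for i < 6; npp(i) = 4i − 12 for even i ≥ 6; and npp(i) = npp(i − 1) (hence npp(i) = 4i − 16) for odd i ≥ 7. -/
/-- `npp i` is the number of minimal non palindrome pairs of length `i`. -/
noncomputable def npp (i : ℕ) : ℕ :=
  {w : List Bool | w.length = i ∧ MNPP w}.ncard

open List in
/-- The palindrome `(d cᵐ)ʲ d`, where `d` is the letter other than `c`. -/
def comb (c : Bool) (m : ℕ) : ℕ → List Bool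
  | 0 => [!c]
  | j + 1 => (!c) :: (replicate m c ++ comb c m j)

/-- The words all of whose factors are palindrome pairs, in explicit form: a power of a letter `c`
on either side of a power of the other letter or of a `comb`. -/
def Good (w : List Bool) : Prop :=
  ∃ (c : Bool) (p q : ℕ) (x : List Bool),
    ((∃ r, x = List.replicate r (!c)) ∨ ∃ m j, x = comb c m j) ∧
      w = List.replicate p c ++ (x ++ List.replicate q c)

open List in
/-- The explicit families of minimal non palindrome pairs. -/
inductive Forbidden : List Bool → Prop
  | wide (c : Bool) (a b : ℕ) :
      Forbidden (c :: (replicate (a + 2) (!c) ++ (replicate (b + 2) c ++ [!c])))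
  | unequal (c : Bool) (a b : ℕ) (h : a ≠ b) :
      Forbidden (c :: (replicate (a + 1) (!c) ++ c :: (replicate (b + 1) (!c) ++ [c])))
  | left (c : Bool) (m : ℕ) : Forbidden (c :: c :: (replicate (m + 2) (!c) ++ [c, !c]))
  | right (c : Bool) (m : ℕ) : Forbidden (c :: (!c) :: (replicate (m + 2) c ++ [!c, !c]))
  | alternating (c : Bool) (j : ℕ) : Forbidden (c :: (comb (!c) 1 (j + 1) ++ [!c, !c]))

section comb

variable (c : Bool) (m j : ℕ)

theorem comb_succ' : comb c m (j + 1) = comb c m j ++ (List.replicate m c ++ [!c]) := by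
  induction j with
  | zero => simp [comb]
  | succ j ih =>
    conv_lhs => rw [comb, ih]
    simp [comb]

theorem reverse_comb : (comb c m j).reverse = comb c m j := by
  induction j with
  | zero => simp [comb]
  | succ j ih =>
    conv_lhs => rw [comb_succ', List.reverse_append, ih]
    simp [comb]

theorem comb_zero_left : comb c 0 j = List.replicate (j + 1) (!c) := by
  induction j with
  | zero => simp [comb]
  | succ j ih => simp [comb, ih, List.replicate_succ]

theorem length_comb_one : (comb c 1 j).length = 2 * j + 1 := by
  induction j with
  | zero => simp [comb]
  | succ j ih => simp [comb, ih]; omega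

theorem getElem?_comb_one (i : ℕ) :
    (comb c 1 j)[i]? = if i ≤ 2 * j then some (if i % 2 = 0 then !c else c) else none := by
  induction j generalizing i with
  | zero => rcases i with _ | i <;> simp [comb]
  | succ j ih =>
    rcases i with _ | _ | i
    · simp [comb]
    · simp [comb]
    · simp [comb, ih, Nat.mul_add, show (i + 1 + 1) % 2 = i % 2 by omega]

end comb

namespace Good

theorem core_reverse {c : Bool} {x : List Bool}
    (hx : (∃ r, x = List.replicate r (!c)) ∨ ∃ m j, x = comb c m j) : x.reverse = x := by
  rcases hx with ⟨r, rfl⟩ | ⟨m, j, rfl⟩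
  · simp
  · exact reverse_comb c m j

theorem palPair {w : List Bool} (h : Good w) : PalPair w := by
  obtain ⟨c, p, q, x, hx, rfl⟩ := h
  have hr := core_reverse hx
  rcases le_total p q with hpq | hpq
  · obtain ⟨k, rfl⟩ := Nat.exists_eq_add_of_le hpq
    refine ⟨List.replicate p c ++ (x ++ List.replicate p c), List.replicate k c,
      List.Palindrome.of_reverse_eq ?_, List.Palindrome.of_reverse_eq ?_, ?_⟩ <;>
      simp [hr]
  · obtain ⟨k, rfl⟩ := Nat.exists_eq_add_of_le' hpq
    refine ⟨List.replicate k c, List.replicate q c ++ (x ++ List.replicate q c),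
      List.Palindrome.of_reverse_eq ?_, List.Palindrome.of_reverse_eq ?_, ?_⟩
    · simp
    · simp [hr]
    · rw [List.replicate_add, List.append_assoc]

theorem reverse {w : List Bool} (h : Good w) : Good w.reverse := by
  obtain ⟨c, p, q, x, hx, rfl⟩ := h
  exact ⟨c, q, p, x, hx, by simp [core_reverse hx]⟩

theorem of_cons {a : Bool} {w : List Bool} (h : Good (a :: w)) : Good w := by
  obtain ⟨c, p, q, x, hx, hw⟩ := h
  rcases p with _ | p
  · rcases hx with ⟨r, rfl⟩ | ⟨m, j, rfl⟩
    · rcases r with _ | r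
      · rcases q with _ | q
        · simp at hw
        · exact ⟨c, 0, q, [], .inl ⟨0, rfl⟩, by
            simpa [List.replicate_succ] using (List.cons.inj hw).2⟩
      · exact ⟨c, 0, q, _, .inl ⟨r, rfl⟩, by simpa [List.replicate_succ] using (List.cons.inj hw).2⟩
    · rcases j with _ | j
      · exact ⟨c, 0, q, [], .inl ⟨0, rfl⟩, by simpa [comb] using (List.cons.inj hw).2⟩
      · exact ⟨c, m, q, _, .inr ⟨m, j, rfl⟩, by simpa [comb] using (List.cons.inj hw).2⟩
  · exact ⟨c, p, q, x, hx, by simpa [List.replicate_succ] using (List.cons.inj hw).2⟩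

theorem of_suffix {u w : List Bool} (h : Good w) (hu : u <:+ w) : Good u := by
  obtain ⟨t, rfl⟩ := hu
  induction t with
  | nil => exact h
  | cons a t ih => exact ih (of_cons h)

theorem of_infix {u w : List Bool} (h : Good w) (hu : u <:+: w) : Good u := by
  obtain ⟨t, hut, htw⟩ := List.infix_iff_suffix_prefix.1 hu
  have := ((h.reverse.of_suffix (List.reverse_suffix.2 htw)).reverse)
  rw [List.reverse_reverse] at this
  exact this.of_suffix hut

end Good

namespace Forbidden

theorem good_tail {w : List Bool} (h : Forbidden w) : Good w.tail := by
  cases h with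
  | wide c a b => exact ⟨!c, a + 2, 1, _, .inl ⟨b + 2, rfl⟩, by simp⟩
  | unequal c a b h => exact ⟨!c, a + 1, 0, _, .inr ⟨b + 1, 1, rfl⟩, by simp [comb]⟩
  | left c m => exact ⟨!c, 0, 1, _, .inr ⟨m + 2, 1, rfl⟩, by simp [comb]⟩
  | right c m => exact ⟨!c, 1, 2, _, .inl ⟨m + 2, rfl⟩, by simp⟩
  | alternating c j => exact ⟨!c, 0, 2, _, .inr ⟨1, j + 1, rfl⟩, by simp⟩

theorem comb_cons (c : Bool) (j : ℕ) (l : List Bool) :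
    c :: (comb c 1 j ++ l) = comb (!c) 1 j ++ (!c) :: l := by
  induction j with
  | zero => simp [comb]
  | succ j ih => simp [comb, ih]

theorem reverse {w : List Bool} (h : Forbidden w) : Forbidden w.reverse := by
  cases h with
  | wide c a b => simpa using wide (!c) b a
  | unequal c a b h => simpa using unequal c b a h.symm
  | left c m => simpa using right (!c) m
  | right c m => simpa using left (!c) m
  | alternating c j =>
    have h := alternating (!c) j
    have hc := comb_cons (!c) (j + 1) [c]
    simp only [Bool.not_not] at h hc
    simpa [reverse_comb, hc] using h

theorem good_of_properFactor {u w : List Bool} (h : Forbidden w) (hu : ProperFactor u w) :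
    Good u := by
  obtain ⟨⟨s, t, hst⟩, hne⟩ := hu
  rcases s with _ | ⟨a, s⟩
  · have hr := h.reverse
    rw [← hst] at hr
    simp only [List.nil_append, List.reverse_append] at hr hst
    rcases ht : t.reverse with _ | ⟨b, t'⟩
    · simp_all
    · rw [ht, List.cons_append] at hr
      have := (Good.of_suffix hr.good_tail (List.suffix_append _ _)).reverse
      rwa [List.reverse_reverse] at this
  · rw [← hst] at h
    exact h.good_tail.of_infix ⟨s, t, rfl⟩

end Forbidden

section

variable (c : Bool) (p q r m j : ℕ)

open List in
theorem good_or_forbidden_replicate :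
    Good ((!c) :: (replicate p c ++ (replicate r (!c) ++ replicate q c))) ∨
      ∃ f, f <:+: (!c) :: (replicate p c ++ (replicate r (!c) ++ replicate q c)) ∧
        Forbidden f := by
  rcases p with _ | p
  · exact .inl ⟨c, 0, q, _, .inl ⟨r + 1, rfl⟩, by simp [replicate_succ]⟩
  rcases q with _ | q
  · exact .inl ⟨!c, 1, r, _, .inl ⟨p + 1, rfl⟩, by simp⟩
  rcases r with _ | _ | r
  · exact .inl ⟨!c, 1, 0, _, .inl ⟨p + 1 + (q + 1), rfl⟩, by simp⟩
  · exact .inl ⟨c, 0, q + 1, _, .inr ⟨p + 1, 1, rfl⟩, by simp [comb]⟩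
  rcases p with _ | p
  · rcases q with _ | q
    · exact .inl ⟨!c, 1, 0, _, .inr ⟨r + 2, 1, rfl⟩, by simp [comb]⟩
    · exact .inr ⟨_, ⟨[], replicate q c, by simp [replicate_succ]⟩, .right (!c) r⟩
  · exact .inr ⟨_, ⟨[], replicate q c, by simp [replicate_succ]⟩, .wide (!c) p r⟩

open List in
theorem good_or_forbidden_comb :
    Good ((!c) :: (replicate p c ++ (comb c (m + 1) j ++ replicate q c))) ∨
      ∃ f, f <:+: (!c) :: (replicate p c ++ (comb c (m + 1) j ++ replicate q c)) ∧
        Forbidden f := by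
  rcases j with _ | j
  · exact good_or_forbidden_replicate c p q 1
  rcases p with _ | p
  · rcases m with _ | m
    · rcases q with _ | _ | q
      · refine .inl ⟨!c, 2, 1, _, .inr ⟨1, j, rfl⟩, ?_⟩
        have hc := Forbidden.comb_cons (!c) j [!c]
        simp only [Bool.not_not] at hc
        simp [comb_succ' c 1 j, replicate_succ, hc]
      · refine .inl ⟨!c, 2, 0, _, .inr ⟨1, j + 1, rfl⟩, ?_⟩
        have hc := Forbidden.comb_cons (!c) (j + 1) []
        simp only [Bool.not_not] at hc
        simpa [replicate_succ] using hc.symm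
      · exact .inr ⟨_, ⟨[], replicate q c, by simp [replicate_succ]⟩, .alternating (!c) j⟩
    · rcases j with _ | j
      · rcases q with _ | q
        · exact .inl ⟨!c, 2, 1, _, .inl ⟨m + 2, rfl⟩, by simp [comb, replicate_succ]⟩
        · exact .inr ⟨_, ⟨[], replicate q c, by simp [comb, replicate_succ]⟩, .left (!c) m⟩
      · exact .inr ⟨_, ⟨[], replicate (m + 1) c ++ (comb c (m + 2) j ++ replicate q c),
          by simp [comb, replicate_succ]⟩, .left (!c) m⟩
  · by_cases h : p = m
    · exact .inl ⟨c, 0, q, _, .inr ⟨m + 1, j + 2, rfl⟩, by simp [comb, h]⟩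
    · refine .inr ⟨_, ⟨[], (comb c (m + 1) j).tail ++ replicate q c, ?_⟩, .unequal (!c) p m h⟩
      cases j <;> simp [comb]

end

open List in
theorem good_or_forbidden (w : List Bool) : Good w ∨ ∃ f, f <:+: w ∧ Forbidden f := by
  induction w with
  | nil => exact .inl ⟨true, 0, 0, [], .inl ⟨0, rfl⟩, rfl⟩
  | cons a w ih =>
    rcases ih with ⟨c, p, q, x, hx, rfl⟩ | ⟨f, hf, hF⟩
    swap
    · exact .inr ⟨f, hf.trans (suffix_cons a w).isInfix, hF⟩
    by_cases hac : a = c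
    · exact .inl ⟨c, p + 1, q, x, hx, by simp [hac, replicate_succ]⟩
    obtain rfl : a = !c := by cases a <;> cases c <;> simp_all
    rcases hx with ⟨r, rfl⟩ | ⟨m, j, rfl⟩
    · exact good_or_forbidden_replicate c p q r
    · rcases m with _ | m
      · rw [comb_zero_left]
        exact good_or_forbidden_replicate c p q (j + 1)
      · exact good_or_forbidden_comb c p q m j

/-- The reflections inside the two palindromes, read off at the level of letters. -/
theorem PalPair.exists_getElem? {w : List Bool} (h : PalPair w) :
    ∃ i ≤ w.length, (∀ j < i, w[j]? = w[i - 1 - j]?) ∧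
      ∀ j < w.length - i, w[i + j]? = w[w.length - 1 - j]? := by
  obtain ⟨p, q, hp, hq, rfl⟩ := h
  refine ⟨p.length, by simp, fun j hj => ?_, fun j hj => ?_⟩
  · rw [List.getElem?_append_left hj, List.getElem?_append_left (by omega)]
    conv_lhs => rw [← hp.reverse_eq]
    rw [List.getElem?_reverse hj]
  · simp only [List.length_append] at hj ⊢
    rw [List.getElem?_append_right (by omega), List.getElem?_append_right (by omega)]
    conv_lhs => rw [← hq.reverse_eq]
    rw [List.getElem?_reverse (by omega)]
    congr 1
    omega

theorem Forbidden.not_palPair {w : List Bool} (hw : Forbidden w) : ¬ PalPair w := by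
  intro h
  obtain ⟨i, hi, h₁, h₂⟩ := h.exists_getElem?
  have h₁0 := h₁ 0
  have h₁1 := h₁ 1
  have h₂0 := h₂ 0
  have h₂1 := h₂ 1
  cases hw with
  | wide c a b =>
    have key (j : ℕ) : (c :: (List.replicate (a + 2) (!c) ++
        (List.replicate (b + 2) c ++ [!c])))[j]? =
        if j = 0 then some c else if j < a + 3 then some (!c) else if j < a + b + 5 then some c else
          if j = a + b + 5 then some (!c) else none := by
      simp only [List.getElem?_cons, List.getElem?_append, List.getElem?_replicate,
        List.length_replicate, List.getElem?_nil]
      split_ifs <;> first | rfl | omega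
    simp only [key, List.length_cons, List.length_append, List.length_replicate,
      List.length_nil] at *
    clear h h₁ h₂ key
    cases c <;> grind (splits := 40)
  | unequal c a b hab =>
    have key (j : ℕ) : (c :: (List.replicate (a + 1) (!c) ++ c ::
        (List.replicate (b + 1) (!c) ++ [c])))[j]? =
        if j = 0 then some c else if j < a + 2 then some (!c) else if j = a + 2 then some c else
          if j < a + b + 4 then some (!c) else if j = a + b + 4 then some c else none := by
      simp only [List.getElem?_cons, List.getElem?_append, List.getElem?_replicate,
        List.length_replicate, List.getElem?_nil]
      split_ifs <;> first | rfl | omega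
    have h₁a := h₁ (a + 2)
    have h₂a := h₂ (a + 2)
    simp only [key, List.length_cons, List.length_append, List.length_replicate,
      List.length_nil] at *
    clear h h₁ h₂ key
    cases c <;> grind (splits := 40)
  | left c m =>
    have key (j : ℕ) : (c :: c :: (List.replicate (m + 2) (!c) ++ [c, !c]))[j]? =
        if j < 2 then some c else if j < m + 4 then some (!c) else if j = m + 4 then some c else
          if j = m + 5 then some (!c) else none := by
      simp only [List.getElem?_cons, List.getElem?_append, List.getElem?_replicate,
        List.length_replicate, List.getElem?_nil]
      split_ifs <;> first | rfl | omega
    simp only [key, List.length_cons, List.length_append, List.length_replicate,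
      List.length_nil] at *
    clear h h₁ h₂ key
    cases c <;> grind (splits := 40)
  | right c m =>
    have key (j : ℕ) : (c :: (!c) :: (List.replicate (m + 2) c ++ [!c, !c]))[j]? =
        if j = 0 then some c else if j = 1 then some (!c) else if j < m + 4 then some c else
          if j < m + 6 then some (!c) else none := by
      simp only [List.getElem?_cons, List.getElem?_append, List.getElem?_replicate,
        List.length_replicate, List.getElem?_nil]
      split_ifs <;> first | rfl | omega
    simp only [key, List.length_cons, List.length_append, List.length_replicate,
      List.length_nil] at *
    clear h h₁ h₂ key
    cases c <;> grind (splits := 40)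
  | alternating c k =>
    have key (j : ℕ) : (c :: (comb (!c) 1 (k + 1) ++ [!c, !c]))[j]? =
        if j = 0 then some c else if j < 2 * k + 4 then some (if j % 2 = 0 then !c else c) else
          if j < 2 * k + 6 then some (!c) else none := by
      simp only [List.getElem?_cons, List.getElem?_append, getElem?_comb_one,
        length_comb_one, List.getElem?_nil, Bool.not_not]
      split_ifs <;> first | rfl | omega
    simp only [key, List.length_cons, List.length_append, length_comb_one,
      List.length_nil] at *
    clear h h₁ h₂ key
    cases c <;> grind (splits := 40)

theorem mnpp_iff_forbidden (w : List Bool) : MNPP w ↔ Forbidden w := by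
  refine ⟨fun ⟨hw, hf⟩ => ?_, fun h => ⟨h.not_palPair, fun u hu => ?_⟩⟩
  · rcases good_or_forbidden w with h | ⟨f, hfw, h⟩
    · exact absurd h.palPair hw
    · by_contra hne
      exact h.not_palPair (hf f ⟨hfw, fun e => hne (e ▸ h)⟩)
  · exact (h.good_of_properFactor hu).palPair

theorem Forbidden.six_le_length {w : List Bool} (h : Forbidden w) : 6 ≤ w.length := by
  cases h <;> simp [length_comb_one] <;> omega

namespace Forbidden

/-- The parameters of the forbidden words of length `n` with a fixed first letter: the family,
together with the length of the second block in the families where it is free. -/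
def params (n : ℕ) : Finset (Σ _ : Fin 5, ℕ) :=
  Finset.univ.sigma ![Finset.Icc 2 (n - 4), {a ∈ Finset.Icc 1 (n - 4) | 2 * a + 3 ≠ n}, {0}, {1},
    if Even n then {0} else ∅]

open List in
/-- The forbidden word of length `n` with given first letter and parameters. -/
def word (n : ℕ) : Bool × (Σ _ : Fin 5, ℕ) → List Bool
  | (c, ⟨0, a⟩) => c :: (replicate a (!c) ++ (replicate (n - 2 - a) c ++ [!c]))
  | (c, ⟨1, a⟩) => c :: (replicate a (!c) ++ c :: (replicate (n - 3 - a) (!c) ++ [c]))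
  | (c, ⟨2, _⟩) => c :: c :: (replicate (n - 4) (!c) ++ [c, !c])
  | (c, ⟨3, _⟩) => c :: (!c) :: (replicate (n - 4) c ++ [!c, !c])
  | (c, ⟨4, _⟩) => c :: (comb (!c) 1 ((n - 4) / 2) ++ [!c, !c])

/-- A left inverse of `word`. -/
def decode (w : List Bool) : Bool × (Σ _ : Fin 5, ℕ) :=
  let c := w.headD false
  (c, ⟨if w.reverse.headD false = c then 1 else
      if w.getD 1 false = c then if w.getD 3 false = c then 4 else 2
      else if w.getD 2 false = c then 3 else 0,
    (w.tail.takeWhile (· != c)).length⟩)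

open List in
theorem word_cases {n : ℕ} (hn : 6 ≤ n) (c : Bool) {x : Σ _ : Fin 5, ℕ} (hx : x ∈ params n) :
    (∃ k l, n = k + l + 6 ∧ x = ⟨0, k + 2⟩ ∧
      word n (c, x) = c :: (replicate (k + 2) (!c) ++ (replicate (l + 2) c ++ [!c]))) ∨
    (∃ k l, n = k + l + 5 ∧ k ≠ l ∧ x = ⟨1, k + 1⟩ ∧
      word n (c, x) = c :: (replicate (k + 1) (!c) ++ c :: (replicate (l + 1) (!c) ++ [c]))) ∨
    (∃ m, n = m + 6 ∧ x = ⟨2, 0⟩ ∧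
      word n (c, x) = c :: c :: (replicate (m + 2) (!c) ++ [c, !c])) ∨
    (∃ m, n = m + 6 ∧ x = ⟨3, 1⟩ ∧
      word n (c, x) = c :: (!c) :: (replicate (m + 2) c ++ [!c, !c])) ∨
    ∃ j, n = 2 * j + 6 ∧ x = ⟨4, 0⟩ ∧
      word n (c, x) = c :: (comb (!c) 1 (j + 1) ++ [!c, !c]) := by
  obtain ⟨t, a⟩ := x
  simp only [params, Finset.mem_sigma, Finset.mem_univ, true_and] at hx
  obtain ⟨m, rfl⟩ := Nat.exists_eq_add_of_le' hn
  fin_cases t <;> simp at hx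
  · obtain ⟨k, rfl⟩ := Nat.exists_eq_add_of_le' hx.1
    obtain ⟨l, rfl⟩ : ∃ l, m = k + l := ⟨m - k, by omega⟩
    exact .inl ⟨k, l, rfl, rfl, by
      simp [word, show k + l + 2 - k = l + 2 by omega]⟩
  · obtain ⟨k, rfl⟩ := Nat.exists_eq_add_of_le' hx.1.1
    obtain ⟨l, hl⟩ : ∃ l, m + 6 = k + l + 5 := ⟨m + 1 - k, by omega⟩
    exact .inr <| .inl ⟨k, l, hl, by omega, rfl, by
      simp [word, show m + 2 - k = l + 1 by omega]⟩
  · exact .inr <| .inr <| .inl ⟨m, rfl, by simp [hx], by simp [word]⟩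
  · exact .inr <| .inr <| .inr <| .inl ⟨m, rfl, by simp [hx], by simp [word]⟩
  · split_ifs at hx with h
    · obtain ⟨r, hr⟩ := h
      exact .inr <| .inr <| .inr <| .inr ⟨r - 3, by omega, by simpa using hx, by
        simp [word, show (m + 2) / 2 = r - 3 + 1 by omega]⟩
    · simp at hx

theorem decode_word {n : ℕ} (hn : 6 ≤ n) (c : Bool) {x : Σ _ : Fin 5, ℕ} (hx : x ∈ params n) :
    decode (word n (c, x)) = (c, x) := by
  obtain ⟨k, l, -, rfl, h⟩ | ⟨k, l, -, -, rfl, h⟩ | ⟨m, -, rfl, h⟩ | ⟨m, -, rfl, h⟩ |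
      ⟨j, -, rfl, h⟩ := word_cases hn c hx
  on_goal 5 => cases j
  all_goals
    rw [h]
    simp [decode, comb, List.replicate_succ]

theorem image_word {n : ℕ} (hn : 6 ≤ n) :
    {w | w.length = n ∧ Forbidden w} = word n ''
      ((Finset.univ ×ˢ params n : Finset (Bool × Σ _ : Fin 5, ℕ)) : Set (Bool × Σ _ : Fin 5, ℕ)) := by
  ext w
  simp only [Set.mem_ofPred_eq, Set.mem_image, Finset.mem_coe, Finset.mem_product,
    Finset.mem_univ, true_and, Prod.exists, Sigma.exists, params, Finset.mem_sigma]
  constructor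
  · rintro ⟨hl, h⟩
    cases h with
    | wide c a b =>
      simp at hl
      exact ⟨c, 0, a + 2, by simp; omega, by simp [word]; omega⟩
    | unequal c a b h =>
      simp at hl
      exact ⟨c, 1, a + 1, by simp; omega, by simp [word]; omega⟩
    | left c m =>
      simp at hl
      exact ⟨c, 2, 0, by simp, by simp [word]; omega⟩
    | right c m =>
      simp at hl
      exact ⟨c, 3, 1, by simp, by simp [word]; omega⟩
    | alternating c j =>
      simp [length_comb_one] at hl
      refine ⟨c, 4, 0, ?_, ?_⟩
      · simp [show Even n from ⟨j + 3, by omega⟩]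
      · simp [word, show (n - 4) / 2 = j + 1 by omega]
  · rintro ⟨c, t, a, hx, rfl⟩
    obtain ⟨k, l, rfl, -, h⟩ | ⟨k, l, rfl, hkl, -, h⟩ | ⟨m, rfl, -, h⟩ | ⟨m, rfl, -, h⟩ |
      ⟨j, rfl, -, h⟩ := word_cases hn c (x := ⟨t, a⟩)
        (Finset.mem_sigma.2 ⟨Finset.mem_univ t, hx⟩) <;>
      rw [h]
    · exact ⟨by simp; omega, wide c k l⟩
    · exact ⟨by simp; omega, unequal c k l hkl⟩
    · exact ⟨by simp, left c m⟩
    · exact ⟨by simp, right c m⟩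
    · exact ⟨by simp [length_comb_one]; omega, alternating c j⟩

theorem card_params_even {n : ℕ} (hn : 6 ≤ n) (h : Even n) : (params n).card = 2 * n - 6 := by
  have : {a ∈ Finset.Icc 1 (n - 4) | 2 * a + 3 ≠ n} = Finset.Icc 1 (n - 4) := by
    refine Finset.filter_true_of_mem fun a _ => ?_
    grind
  simp [params, Finset.card_sigma, Fin.sum_univ_five, this, h]
  omega

theorem card_params_odd {n : ℕ} (hn : 6 ≤ n) (h : Odd n) : (params n).card = 2 * n - 8 := by
  have : {a ∈ Finset.Icc 1 (n - 4) | 2 * a + 3 ≠ n} =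
      (Finset.Icc 1 (n - 4)).erase ((n - 3) / 2) := by
    ext a
    simp only [Finset.mem_filter, Finset.mem_erase]
    grind
  have hm : (n - 3) / 2 ∈ Finset.Icc 1 (n - 4) := by
    simp
    grind
  simp [params, Finset.card_sigma, Fin.sum_univ_five, this, Nat.not_even_iff_odd.2 h,
    Finset.card_erase_of_mem hm]
  omega

end Forbidden

theorem npp_eq_card {n : ℕ} (hn : 6 ≤ n) : npp n = 2 * (Forbidden.params n).card := by
  simp only [npp, mnpp_iff_forbidden]
  rw [Forbidden.image_word hn, Set.InjOn.ncard_image, Set.ncard_coe_finset,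
    Finset.card_product]
  · simp
  · refine Set.LeftInvOn.injOn (f₁' := Forbidden.decode) ?_
    rintro ⟨c, x⟩ hx
    exact Forbidden.decode_word hn c (by simpa using hx)

theorem npp_of_even {n : ℕ} (hn : 6 ≤ n) (h : Even n) : npp n = 4 * n - 12 := by
  rw [npp_eq_card hn, Forbidden.card_params_even hn h]
  omega

theorem npp_of_odd {n : ℕ} (hn : 6 ≤ n) (h : Odd n) : npp n = 4 * n - 16 := by
  rw [npp_eq_card hn, Forbidden.card_params_odd hn h]
  omega

/-- Counting minimal non palindrome pairs: `npp i = 0` for `i < 6`,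
`npp i = 4i - 12` for even `i ≥ 6`, and `npp i = npp (i-1) = 4i - 16` for odd
`i ≥ 7`. -/
theorem npp_count :
    (∀ i, i < 6 → npp i = 0) ∧
    (∀ i, 6 ≤ i → Even i → npp i = 4 * i - 12) ∧
    (∀ i, 7 ≤ i → Odd i → npp i = npp (i - 1) ∧ npp i = 4 * i - 16) := by
  refine ⟨fun i hi => ?_, fun i => npp_of_even, fun i hi h => ⟨?_, npp_of_odd (by omega) h⟩⟩
  · simp only [npp, mnpp_iff_forbidden]
    convert Set.ncard_empty (List Bool)
    refine Set.eq_empty_of_forall_notMem fun w hw => ?_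
    have := hw.2.six_le_length
    have := hw.1
    omega
  · rw [npp_of_odd (by omega) h, npp_of_even (by omega) (by grind)]
    omega
end
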